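/- Let X and Y be complex Banach spaces and let k ∈ ℕ. If P = ∑_{j=0}^k P_j is a continuous polynomial of degree at most k from X to Y (P_0 constant and, for j ≥ 1, P_j(x) = M_j(x,…,x) for a continuous j-linear map M_j : X^j → Y), then for every 0 ≤ j ≤ k one has sup_{‖x‖≤1} ‖P_j(x)‖ ≤ sup_{‖x‖≤1} ‖P(x)‖. -/

import Mathlib

open Metric Filter

noncomputable def supOnBall {X W : Type*} [NormedAddCommGroup X] [NormedAddCommGroup W]
    (s : ℝ) (f : X → W) : ℝ :=
  sSup ((fun x => ‖f x‖) '' Metric.closedBall (0 : X) s)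

def IsHomogPoly (𝕜 : Type*) [NontriviallyNormedField 𝕜] {X Y : Type*}
    [NormedAddCommGroup X] [NormedSpace 𝕜 X] [NormedAddCommGroup Y] [NormedSpace 𝕜 Y]
    (N : ℕ) (P : X → Y) : Prop :=
  ∃ M : ContinuousMultilinearMap 𝕜 (fun _ : Fin N => X) Y, ∀ x, P x = M (fun _ => x)

def IsPolyDegLE (𝕜 : Type*) [NontriviallyNormedField 𝕜] {X Y : Type*}
    [NormedAddCommGroup X] [NormedSpace 𝕜 X] [NormedAddCommGroup Y] [NormedSpace 𝕜 Y]
    (k : ℕ) (P : X → Y) : Prop :=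
  ∃ Pc : ℕ → X → Y, (∀ j, j ≤ k → IsHomogPoly 𝕜 j (Pc j)) ∧
    ∀ x, P x = ∑ j ∈ Finset.range (k + 1), Pc j x

def MemAu {X W : Type*} [NormedAddCommGroup X] [NormedSpace ℂ X]
    [NormedAddCommGroup W] [NormedSpace ℂ W] (f : X → W) : Prop :=
  DifferentiableOn ℂ f (Metric.ball (0 : X) 1) ∧
    UniformContinuousOn f (Metric.closedBall (0 : X) 1)

theorem IsHomogPoly.map_smul {𝕜 : Type*} [NontriviallyNormedField 𝕜] {X Y : Type*}
    [NormedAddCommGroup X] [NormedSpace 𝕜 X] [NormedAddCommGroup Y] [NormedSpace 𝕜 Y]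
    {N : ℕ} {P : X → Y} (h : IsHomogPoly 𝕜 N P) (c : 𝕜) (x : X) :
    P (c • x) = c ^ N • P x := by
  obtain ⟨M, hM⟩ := h
  simpa [hM] using M.map_smul_univ (fun _ => c) (fun _ => x)

theorem IsHomogPoly.exists_bound {𝕜 : Type*} [NontriviallyNormedField 𝕜] {X Y : Type*}
    [NormedAddCommGroup X] [NormedSpace 𝕜 X] [NormedAddCommGroup Y] [NormedSpace 𝕜 Y]
    {N : ℕ} {P : X → Y} (h : IsHomogPoly 𝕜 N P) :
    ∃ C, ∀ x, ‖x‖ ≤ 1 → ‖P x‖ ≤ C := by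
  obtain ⟨M, hM⟩ := h
  refine ⟨‖M‖, fun x hx => ?_⟩
  rw [hM]
  refine (M.le_opNorm _).trans (mul_le_of_le_one_right (norm_nonneg _) ?_)
  simpa using pow_le_one₀ (norm_nonneg x) hx

/-- Orthogonality of the characters of the group of `n`-th roots of unity. -/
theorem IsPrimitiveRoot.sum_pow_sub_add_mul {R : Type*} [CommRing R] [IsDomain R] {ω : R} {n : ℕ}
    (hω : IsPrimitiveRoot ω n) {i j : ℕ} (hi : i < n) (hj : j < n) :
    ∑ m ∈ Finset.range n, ω ^ (m * (n - j)) * (ω ^ m) ^ i = if i = j then (n : R) else 0 := by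
  have hterm : ∀ m, ω ^ (m * (n - j)) * (ω ^ m) ^ i = (ω ^ (n - j + i)) ^ m := fun m => by ring
  simp only [hterm]
  split_ifs with hij
  · have hn : n - j + i = n := by omega
    simp [hn, hω.pow_eq_one]
  · have hne : ω ^ (n - j + i) ≠ 1 := by
      rw [Ne, hω.pow_eq_one_iff_dvd]
      rintro ⟨c, hc⟩
      rcases c with _ | _ | c
      · omega
      · omega
      · have : n * (c + 1 + 1) = n * c + n + n := by ring
        have := Nat.zero_le (n * c)
        omega
    refine (mul_eq_zero.1 (?_ : (ω ^ (n - j + i) - 1) * _ = 0)).resolve_left (sub_ne_zero.2 hne)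
    rw [mul_geom_sum, ← pow_mul, mul_comm, pow_mul, hω.pow_eq_one, one_pow, sub_self]

theorem stmt0 {X Y : Type*} [NormedAddCommGroup X] [NormedSpace ℂ X] [CompleteSpace X]
    [NormedAddCommGroup Y] [NormedSpace ℂ Y] [CompleteSpace Y]
    (k : ℕ) (Pc : ℕ → X → Y) (hhom : ∀ j, j ≤ k → IsHomogPoly ℂ j (Pc j))
    (P : X → Y) (hsum : ∀ x, P x = ∑ j ∈ Finset.range (k + 1), Pc j x) :
    ∀ j, j ≤ k → supOnBall 1 (Pc j) ≤ supOnBall 1 P := by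
  intro j hj
  choose! C hC using fun i hi => (hhom i hi).exists_bound
  have hbdd : BddAbove ((fun x => ‖P x‖) '' Metric.closedBall (0 : X) 1) := by
    refine ⟨∑ i ∈ Finset.range (k + 1), C i, ?_⟩
    rintro _ ⟨x, hx, rfl⟩
    simp only [hsum]
    exact norm_sum_le_of_le _ fun i hi =>
      hC i (Nat.le_of_lt_succ (Finset.mem_range.1 hi)) x (mem_closedBall_zero_iff.1 hx)
  refine csSup_le ((Metric.nonempty_closedBall.2 zero_le_one).image _) ?_
  rintro _ ⟨x, hx, rfl⟩
  rw [mem_closedBall_zero_iff] at hx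
  obtain ⟨ω, hω⟩ : ∃ ω : ℂ, IsPrimitiveRoot ω (k + 1) :=
    ⟨_, Complex.isPrimitiveRoot_exp (k + 1) k.succ_ne_zero⟩
  have hω1 : ‖ω‖ = 1 := hω.norm'_eq_one k.succ_ne_zero
  have hrec : ∑ m ∈ Finset.range (k + 1), ω ^ (m * (k + 1 - j)) • P (ω ^ m • x) =
      ((k + 1 : ℕ) : ℂ) • Pc j x := by
    calc
      _ = ∑ m ∈ Finset.range (k + 1), ∑ i ∈ Finset.range (k + 1),
          (ω ^ (m * (k + 1 - j)) * (ω ^ m) ^ i) • Pc i x := by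
        refine Finset.sum_congr rfl fun m _ => ?_
        rw [hsum, Finset.smul_sum]
        refine Finset.sum_congr rfl fun i hi => ?_
        rw [(hhom i (Nat.le_of_lt_succ (Finset.mem_range.1 hi))).map_smul, smul_smul]
      _ = ∑ i ∈ Finset.range (k + 1), (if i = j then ((k + 1 : ℕ) : ℂ) else 0) • Pc i x := by
        rw [Finset.sum_comm]
        refine Finset.sum_congr rfl fun i hi => ?_
        rw [← Finset.sum_smul,
          hω.sum_pow_sub_add_mul (Finset.mem_range.1 hi) (Nat.lt_succ_of_le hj)]
      _ = _ := by
        simp only [ite_smul, zero_smul]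
        rw [Finset.sum_ite_eq', if_pos (Finset.mem_range.2 (Nat.lt_succ_of_le hj))]
  have hle : ((k + 1 : ℕ) : ℝ) * ‖Pc j x‖ ≤ ((k + 1 : ℕ) : ℝ) * supOnBall 1 P := by
    calc
      _ = ‖((k + 1 : ℕ) : ℂ) • Pc j x‖ := by rw [norm_smul, Complex.norm_natCast]
      _ ≤ ∑ _m ∈ Finset.range (k + 1), supOnBall 1 P := by
        rw [← hrec]
        refine norm_sum_le_of_le _ fun m _ => ?_
        rw [norm_smul, norm_pow, hω1, one_pow, one_mul]
        refine le_csSup hbdd ⟨_, ?_, rfl⟩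
        rwa [mem_closedBall_zero_iff, norm_smul, norm_pow, hω1, one_pow, one_mul]
      _ = _ := by simp
  exact le_of_mul_le_mul_left hle (by positivity)
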